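/- Let χ be a proper 3-coloring of T_{L,d} and let W ⊆ V satisfy ∂_int W ⊆ O, ∂_ext W ⊆ E, and χ⁻¹(0) ∩ (∂_int W ∪ ∂_ext W) = ∅. Then for every direction s ∈ {±1,…,±d}, every S ⊆ W^s and every vertex v ∈ V: χ(v) = χ^s_S(v) if v ∉ W, and χ(v) = f(χ^s_S(σ_s(v))) if v ∈ W. In particular, χ can be uniquely reconstructed from any element of {χ^s_S : S ⊆ W^s} together with W and s. -/

import Mathlib

open Finset

/-- Vertices of the discrete torus `T_{L,d}`: functions from `Fin d` to `Fin L`. -/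
abbrev TV (L d : ℕ) : Type := Fin d → Fin L

/-- Adjacency in the discrete torus `T_{L,d}`: `x` and `y` differ in exactly one
coordinate, and differ by `1 (mod L)` in that coordinate. -/
def TorusAdj {L d : ℕ} (x y : TV L d) : Prop :=
  ∃ i : Fin d, x i ≠ y i ∧
    ((y i : ℕ) = ((x i : ℕ) + 1) % L ∨ (x i : ℕ) = ((y i : ℕ) + 1) % L) ∧
    ∀ j : Fin d, j ≠ i → x j = y j

instance {L d : ℕ} (x y : TV L d) : Decidable (TorusAdj x y) := by
  unfold TorusAdj; infer_instance

/-- A vertex of the torus is even if its coordinate sum is even. -/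
def IsEvenVtx {L d : ℕ} (x : TV L d) : Prop := (∑ i, (x i : ℕ)) % 2 = 0

instance {L d : ℕ} (x : TV L d) : Decidable (IsEvenVtx x) := by
  unfold IsEvenVtx; infer_instance

/-- Proper 3-colorings of `T_{L,d}`. -/
def ProperColoring (L d : ℕ) (χ : TV L d → Fin 3) : Prop :=
  ∀ x y : TV L d, TorusAdj x y → χ x ≠ χ y

instance (L d : ℕ) : DecidablePred (ProperColoring L d) := by
  intro χ; unfold ProperColoring; infer_instance

/-- The set (as a type) of proper 3-colorings of `T_{L,d}`. -/
abbrev Coloring3 (L d : ℕ) : Type := {χ : TV L d → Fin 3 // ProperColoring L d χ}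

/-- `|χ⁻¹(0) ∩ E|`: the number of even vertices colored 0. -/
noncomputable def zeroEvenCount (L d : ℕ) (χ : TV L d → Fin 3) : ℕ :=
  Nat.card {v : TV L d // χ v = 0 ∧ IsEvenVtx v}

/-- `|χ⁻¹(0) ∩ O|`: the number of odd vertices colored 0. -/
noncomputable def zeroOddCount (L d : ℕ) (χ : TV L d → Fin 3) : ℕ :=
  Nat.card {v : TV L d // χ v = 0 ∧ ¬ IsEvenVtx v}

/-- Balanced colorings: `||χ⁻¹(0)∩E| - |χ⁻¹(0)∩O|| ≤ ρ L^d / 2`. -/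
def BalancedColoring (L d : ℕ) (ρ : ℝ) (χ : TV L d → Fin 3) : Prop :=
  |(zeroEvenCount L d χ : ℝ) - (zeroOddCount L d χ : ℝ)| ≤ ρ * (L : ℝ) ^ d / 2

/-- Colorings where color 0 predominates on the even sublattice:
`|χ⁻¹(0)∩E| > |χ⁻¹(0)∩O| + ρ L^d / 2`. -/
def EvenMajorityColoring (L d : ℕ) (ρ : ℝ) (χ : TV L d → Fin 3) : Prop :=
  (zeroOddCount L d χ : ℝ) + ρ * (L : ℝ) ^ d / 2 < (zeroEvenCount L d χ : ℝ)

/-- The uniform measure, on proper 3-colorings of `T_{L,d}`, of the set of proper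
3-colorings satisfying the predicate `P`. -/
noncomputable def pi3 (L d : ℕ) (P : (TV L d → Fin 3) → Prop) : ℝ :=
  (Nat.card {χ : TV L d → Fin 3 // ProperColoring L d χ ∧ P χ} : ℝ) /
    (Nat.card (Coloring3 L d) : ℝ)

/-- The binary entropy function `H(x) = -x log₂ x - (1-x) log₂ (1-x)`. -/
noncomputable def binEntropy (x : ℝ) : ℝ :=
  -(x * Real.logb 2 x) - (1 - x) * Real.logb 2 (1 - x)

/-- External vertex boundary `∂_ext X`. -/
def extBdry {L d : ℕ} (X : Set (TV L d)) : Set (TV L d) :=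
  {y | y ∉ X ∧ ∃ x ∈ X, TorusAdj y x}

/-- Internal vertex boundary `∂_int X`. -/
def intBdry {L d : ℕ} (X : Set (TV L d)) : Set (TV L d) :=
  {x | x ∈ X ∧ ∃ y, y ∉ X ∧ TorusAdj x y}

/-- The even part `W ∩ E`. -/
def evenPart {L d : ℕ} (W : Set (TV L d)) : Set (TV L d) := {v ∈ W | IsEvenVtx v}

/-- The odd part `W ∩ O`. -/
def oddPart {L d : ℕ} (W : Set (TV L d)) : Set (TV L d) := {v ∈ W | ¬ IsEvenVtx v}

/-- The size `|∇(W)|` of the edge boundary of `W`: each boundary edge is counted once,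
as the ordered pair whose first coordinate is inside `W`. -/
noncomputable def cutsetCard (L d : ℕ) (W : Set (TV L d)) : ℕ :=
  Nat.card {p : TV L d × TV L d // p.1 ∈ W ∧ p.2 ∉ W ∧ TorusAdj p.1 p.2}

/-- Add one (mod `L`) in `Fin L`. -/
def fSucc {L : ℕ} (a : Fin L) : Fin L :=
  ⟨((a : ℕ) + 1) % L, Nat.mod_lt _ (Nat.lt_of_le_of_lt (Nat.zero_le _) a.isLt)⟩

/-- Subtract one (mod `L`) in `Fin L`. -/
def fPred {L : ℕ} (a : Fin L) : Fin L :=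
  ⟨((a : ℕ) + (L - 1)) % L, Nat.mod_lt _ (Nat.lt_of_le_of_lt (Nat.zero_le _) a.isLt)⟩

/-- The shift `σ_s` in direction `s`: a direction is a coordinate `s.1` together with
a sign `s.2` (`true` is the positive direction). -/
def dirShift {L d : ℕ} (s : Fin d × Bool) (x : TV L d) : TV L d :=
  fun j => if j = s.1 then (if s.2 then fSucc (x j) else fPred (x j)) else x j

/-- The direction `-s`. -/
def negDir {d : ℕ} (s : Fin d × Bool) : Fin d × Bool := (s.1, !s.2)

/-- `W^s = {x ∈ ∂_int W : σ_{-s}(x) ∉ W}`. -/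
def sideSet {L d : ℕ} (W : Set (TV L d)) (s : Fin d × Bool) : Set (TV L d) :=
  {x | x ∈ intBdry W ∧ dirShift (negDir s) x ∉ W}

/-- The map `f` on colors fixing `0` and transposing `1` and `2`. -/
def colorSwap : Fin 3 → Fin 3 := fun c => if c = 1 then 2 else if c = 2 then 1 else 0

open Classical in
/-- The modified coloring `χ^s_S`: equal to `0` on `S`, to `χ` on `(W^s ∖ S) ∪ (V ∖ W)`,
and to `f(χ(σ_{-s}(v)))` on `W ∖ W^s`. -/
noncomputable def shiftedColoring (L d : ℕ) (χ : TV L d → Fin 3) (W : Set (TV L d))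
    (s : Fin d × Bool) (S : Set (TV L d)) : TV L d → Fin 3 :=
  fun v =>
    if v ∈ S then 0
    else if v ∈ W ∧ v ∉ sideSet W s then colorSwap (χ (dirShift (negDir s) v))
    else χ v

lemma colorSwap_colorSwap (c : Fin 3) : colorSwap (colorSwap c) = c := by
  revert c; decide

lemma colorSwap_eq_of_ne {a b : Fin 3} (ha : a ≠ 0) (hb : b ≠ 0) (hab : a ≠ b) :
    colorSwap b = a := by
  revert a b; decide

lemma val_add_one_mod_cases {L : ℕ} (a : Fin L) :
    ((a : ℕ) + 1 < L ∧ ((a : ℕ) + 1) % L = (a : ℕ) + 1) ∨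
      ((a : ℕ) + 1 = L ∧ ((a : ℕ) + 1) % L = 0) := by
  rcases Nat.lt_or_ge ((a : ℕ) + 1) L with h | h
  · exact Or.inl ⟨h, Nat.mod_eq_of_lt h⟩
  · have h' : (a : ℕ) + 1 = L := by omega
    exact Or.inr ⟨h', by rw [h', Nat.mod_self]⟩

lemma fPred_fSucc {L : ℕ} (a : Fin L) : fPred (fSucc a) = a := by
  apply Fin.ext
  have ha := a.isLt
  simp only [fPred, fSucc]
  rcases val_add_one_mod_cases a with ⟨h, e⟩ | ⟨h, e⟩
  · rw [e, show (a : ℕ) + 1 + (L - 1) = a + L by omega, Nat.add_mod_right, Nat.mod_eq_of_lt ha]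
  · rw [e, Nat.mod_eq_of_lt (by omega)]
    omega

lemma fSucc_fPred {L : ℕ} (a : Fin L) : fSucc (fPred a) = a := by
  apply Fin.ext
  have ha := a.isLt
  simp only [fPred, fSucc]
  rw [Nat.mod_add_mod, show (a : ℕ) + (L - 1) + 1 = a + L by omega, Nat.add_mod_right,
    Nat.mod_eq_of_lt ha]

lemma fSucc_ne {L : ℕ} (hL : 2 ≤ L) (a : Fin L) : fSucc a ≠ a := by
  intro h
  have h' : ((a : ℕ) + 1) % L = a := congrArg Fin.val h
  rcases val_add_one_mod_cases a with ⟨_, e⟩ | ⟨_, e⟩ <;> omega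

lemma dirShift_negDir_dirShift {L d : ℕ} (s : Fin d × Bool) (x : TV L d) :
    dirShift (negDir s) (dirShift s x) = x := by
  obtain ⟨i, b⟩ := s
  funext j
  by_cases hj : j = i <;> cases b <;> simp [dirShift, negDir, hj, fPred_fSucc, fSucc_fPred]

lemma TorusAdj.symm {L d : ℕ} {x y : TV L d} (h : TorusAdj x y) : TorusAdj y x := by
  obtain ⟨i, hne, hor, heq⟩ := h
  exact ⟨i, hne.symm, hor.symm, fun j hj => (heq j hj).symm⟩

lemma torusAdj_dirShift {L d : ℕ} (hL : 2 ≤ L) (s : Fin d × Bool) (x : TV L d) :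
    TorusAdj x (dirShift s x) := by
  obtain ⟨i, b⟩ := s
  refine ⟨i, ?_, ?_, fun j hj => by simp [dirShift, hj]⟩
  · cases b
    · simpa [dirShift, fSucc_fPred] using fSucc_ne hL (fPred (x i))
    · simpa [dirShift] using (fSucc_ne hL (x i)).symm
  · cases b
    · right
      simpa [dirShift, fSucc] using (congrArg Fin.val (fSucc_fPred (x i))).symm
    · left
      simp [dirShift, fSucc]

/-- Claim 4.2: `χ` can be uniquely reconstructed from `χ^s_S`, `W`
and `s`, via `χ(v) = χ^s_S(v)` for `v ∉ W` and `χ(v) = f(χ^s_S(σ_s(v)))` for `v ∈ W`. -/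
theorem shiftedColoring_reconstruction (L d : ℕ) (hL : Even L) (hL4 : 4 ≤ L)
    (χ : TV L d → Fin 3) (hχ : ProperColoring L d χ) (W : Set (TV L d))
    (h1 : ∀ x ∈ intBdry W, ¬ IsEvenVtx x)
    (h2 : ∀ x ∈ extBdry W, IsEvenVtx x)
    (h3 : ∀ x ∈ intBdry W ∪ extBdry W, χ x ≠ 0)
    (s : Fin d × Bool) (S : Set (TV L d)) (hS : S ⊆ sideSet W s) :
    (∀ v : TV L d, v ∉ W → χ v = shiftedColoring L d χ W s S v) ∧
      (∀ v : TV L d, v ∈ W →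
        χ v = colorSwap (shiftedColoring L d χ W s S (dirShift s v))) := by
  have hSW : ∀ v, v ∈ S → v ∈ W := fun v hv => (hS hv).1.1
  have hout : ∀ v, v ∉ W → shiftedColoring L d χ W s S v = χ v := fun v hv => by
    simp [shiftedColoring, mt (hSW v) hv, hv]
  refine ⟨fun v hv => (hout v hv).symm, fun v hv => ?_⟩
  have hadj := torusAdj_dirShift (by omega : 2 ≤ L) s v
  by_cases hu : dirShift s v ∈ W
  · have hside : dirShift s v ∉ sideSet W s := fun h =>
      h.2 (by rwa [dirShift_negDir_dirShift])
    have hval : shiftedColoring L d χ W s S (dirShift s v) = colorSwap (χ v) := by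
      simp [shiftedColoring, mt (@hS (dirShift s v)) hside, hu, hside, dirShift_negDir_dirShift]
    rw [hval, colorSwap_colorSwap]
  · rw [hout _ hu]
    exact (colorSwap_eq_of_ne (h3 v (Or.inl ⟨hv, _, hu, hadj⟩))
      (h3 _ (Or.inr ⟨hu, v, hv, hadj.symm⟩)) (hχ _ _ hadj)).symm
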